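/- For distinct complex numbers z_1,...,z_n with z_a - z_b ≠ ℏ for all a,b, the product over a = 1,...,n of the qKZ elements K_a^{(n)} = (z_a - z_{a-1} + ℏσ_{a-1,a})···(z_a - z_1 + ℏσ_{1,a})(z_a - z_n + ℏσ_{a,n})···(z_a - z_{a+1} + ℏσ_{a,a+1}) equals the scalar ∏_{a≠b} (z_a - z_b + ℏ) times the identity of C[S_n]; in particular each K_a^{(n)} is invertible in C[S_n]. -/

import Mathlib

noncomputable section

/-- The qKZ element `K_a^{(n)} = (z_a - z_{a-1} + ℏσ_{a-1,a})⋯(z_a - z_1 + ℏσ_{1,a})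
 ⋅ (z_a - z_n + ℏσ_{a,n})⋯(z_a - z_{a+1} + ℏσ_{a,a+1})` in `ℂ[S_n]`
(empty products are `1`). -/
def qKZ (n : ℕ) (z : Fin n → ℂ) (ℏ : ℂ) (a : Fin n) :
    MonoidAlgebra ℂ (Equiv.Perm (Fin n)) :=
  (((List.finRange n).filter (fun b => b < a)).reverse.map
      (fun b => algebraMap ℂ (MonoidAlgebra ℂ (Equiv.Perm (Fin n))) (z a - z b)
        + ℏ • MonoidAlgebra.of ℂ (Equiv.Perm (Fin n)) (Equiv.swap b a))).prod *
  (((List.finRange n).filter (fun b => a < b)).reverse.map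
      (fun b => algebraMap ℂ (MonoidAlgebra ℂ (Equiv.Perm (Fin n))) (z a - z b)
        + ℏ • MonoidAlgebra.of ℂ (Equiv.Perm (Fin n)) (Equiv.swap a b))).prod

section helpers

variable {ι A : Type*} [Ring A] [Algebra ℂ A]

/-- Commuting one element past a list product of products. -/
lemma qaux_split (R : ι → ι → A) (x : ι) (s : List ι) (p : List ι)
    (hp : p.Nodup)
    (hcomm : ∀ a ∈ p, ∀ b ∈ p, a ≠ b → ∀ k ∈ s, Commute (R a x) (R b k)) :
    (p.map (fun a => ((x :: s).reverse.map (R a)).prod)).prod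
      = (p.map (fun a => (s.reverse.map (R a)).prod)).prod * (p.map (fun a => R a x)).prod := by
  induction p with
  | nil => simp
  | cons a p ih =>
    rw [List.nodup_cons] at hp
    have ih' := ih hp.2 (fun a ha b hb hab k hk =>
      hcomm a (List.mem_cons_of_mem _ ha) b (List.mem_cons_of_mem _ hb) hab k hk)
    have hc : Commute (R a x) (p.map (fun a => (s.reverse.map (R a)).prod)).prod := by
      apply Commute.list_prod_right
      intro y hy
      obtain ⟨b, hb, rfl⟩ := List.mem_map.1 hy
      apply Commute.list_prod_right
      intro y hy
      obtain ⟨k, hk, rfl⟩ := List.mem_map.1 hy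
      exact hcomm a List.mem_cons_self b (List.mem_cons_of_mem _ hb)
        (fun h => hp.1 (h ▸ hb)) k (List.mem_reverse.1 hk)
    rw [List.map_cons, List.prod_cons, ih']
    simp only [List.map_cons, List.prod_cons, List.reverse_cons, List.map_append,
      List.prod_append, List.map_nil, List.prod_nil, mul_one]
    simp only [mul_assoc]
    congr 1
    rw [← mul_assoc, hc.eq, mul_assoc]

lemma qaux_cancel (R : ι → ι → A) (c : ι → ι → ℂ) (x : ι) (p : List ι)
    (h : ∀ a ∈ p, R a x * R x a = algebraMap ℂ A (c a x)) :
    (p.map (fun a => R a x)).prod * (p.reverse.map (R x)).prod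
      = algebraMap ℂ A (p.map (fun a => c a x)).prod := by
  induction p with
  | nil => simp
  | cons a p ih =>
    have ih' := ih (fun b hb => h b (List.mem_cons_of_mem _ hb))
    simp only [List.map_cons, List.prod_cons, List.reverse_cons, List.map_append,
      List.prod_append, List.map_nil, List.prod_nil, mul_one]
    calc _ = R a x * ((p.map (fun a => R a x)).prod * (p.reverse.map (R x)).prod) * R x a := by
            simp only [mul_assoc]
      _ = _ := by
        rw [ih', ← Algebra.commutes, mul_assoc, h a List.mem_cons_self, ← map_mul, mul_comm]

lemma qaux_main (R : ι → ι → A) (c : ι → ι → ℂ) (K : ι → A) (C : ι → ℂ) (l : List ι)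
    (hl : l.Nodup)
    (hinv : ∀ a b, a ≠ b → R a b * R b a = algebraMap ℂ A (c a b))
    (hcomm : ∀ a x b k, a ≠ b → a ≠ k → x ≠ b → x ≠ k → Commute (R a x) (R b k))
    (hK : ∀ p x s, p ++ x :: s = l →
      K x = (p.reverse.map (R x)).prod * (s.reverse.map (R x)).prod)
    (hC : ∀ p x s, p ++ x :: s = l → C x = (p.map (fun a => c a x)).prod)
    (s : List ι) : ∀ p, p ++ s = l →
    (p.map (fun a => (s.reverse.map (R a)).prod)).prod * (s.map K).prod
      = algebraMap ℂ A (s.map C).prod := by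
  induction s with
  | nil => intro p _; simp
  | cons x s ih =>
    intro p hps
    have hnd := hl
    rw [← hps] at hnd
    have hnd' := List.nodup_append.1 hnd
    have hxs := List.nodup_cons.1 hnd'.2.1
    have ih' := ih (p ++ [x]) (by simpa using hps)
    rw [qaux_split R x s p hnd'.1]
    · rw [List.map_cons, List.prod_cons, hK p x s hps, List.map_cons, List.prod_cons, map_mul,
        hC p x s hps, ← qaux_cancel R c x p, ← ih', qaux_cancel R c x p]
      · simp only [List.map_append, List.prod_append, List.map_cons, List.map_nil, List.prod_cons,
          List.prod_nil, mul_one]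
        rw [← mul_assoc, ← mul_assoc, mul_assoc _ (List.map (fun a => R a x) p).prod,
          qaux_cancel R c x p]
        · rw [← Algebra.commutes]; simp only [mul_assoc]
        · intro a ha; exact hinv a x (hnd'.2.2 a ha x List.mem_cons_self)
      · intro a ha; exact hinv a x (hnd'.2.2 a ha x List.mem_cons_self)
      · intro a ha; exact hinv a x (hnd'.2.2 a ha x List.mem_cons_self)
    · intro a ha b hb hab k hk
      exact hcomm a x b k hab (hnd'.2.2 a ha k (List.mem_cons_of_mem _ hk))
        (hnd'.2.2 b hb x List.mem_cons_self).symm (fun h => hxs.1 (h ▸ hk))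

end helpers

/-- the R-matrix -/
def qR (n : ℕ) (z : Fin n → ℂ) (ℏ : ℂ) (a b : Fin n) : MonoidAlgebra ℂ (Equiv.Perm (Fin n)) :=
  algebraMap ℂ (MonoidAlgebra ℂ (Equiv.Perm (Fin n))) (z a - z b)
        + ℏ • MonoidAlgebra.of ℂ (Equiv.Perm (Fin n)) (Equiv.swap a b)

lemma qR_inv (n : ℕ) (z : Fin n → ℂ) (ℏ : ℂ) (a b : Fin n) :
    qR n z ℏ a b * qR n z ℏ b a
      = algebraMap ℂ _ ((z a - z b + ℏ) * (z b - z a + ℏ)) := by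
  have hs : MonoidAlgebra.of ℂ (Equiv.Perm (Fin n)) (Equiv.swap a b) *
      MonoidAlgebra.of ℂ (Equiv.Perm (Fin n)) (Equiv.swap a b) = 1 := by
    rw [← map_mul, Equiv.swap_mul_self, map_one]
  unfold qR
  rw [Equiv.swap_comm b a]
  generalize MonoidAlgebra.of ℂ (Equiv.Perm (Fin n)) (Equiv.swap a b) = S at hs
  simp only [Algebra.algebraMap_eq_smul_one, mul_add, add_mul, smul_mul_smul_comm, hs, mul_one,
    one_mul]
  module

lemma qR_comm (n : ℕ) (z : Fin n → ℂ) (ℏ : ℂ) (a x b k : Fin n)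
    (h1 : a ≠ b) (h2 : a ≠ k) (h3 : x ≠ b) (h4 : x ≠ k) :
    Commute (qR n z ℏ a x) (qR n z ℏ b k) := by
  have hs : Commute (MonoidAlgebra.of ℂ (Equiv.Perm (Fin n)) (Equiv.swap a x))
      (MonoidAlgebra.of ℂ (Equiv.Perm (Fin n)) (Equiv.swap b k)) := by
    apply Commute.map
    apply Equiv.Perm.Disjoint.commute
    intro y
    by_cases hy : y = a ∨ y = x
    · right; apply Equiv.swap_apply_of_ne_of_ne <;> grind
    · left; apply Equiv.swap_apply_of_ne_of_ne <;> grind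
  unfold qR
  apply Commute.add_left
  · exact Algebra.commutes _ _
  · apply Commute.smul_left
    apply Commute.add_right
    · exact (Algebra.commutes _ _).symm
    · exact hs.smul_right _

lemma qKZ_eq (n : ℕ) (z : Fin n → ℂ) (ℏ : ℂ) (a : Fin n) :
    qKZ n z ℏ a = (((List.finRange n).filter (fun b => b < a)).reverse.map (qR n z ℏ a)).prod *
      (((List.finRange n).filter (fun b => a < b)).reverse.map (qR n z ℏ a)).prod := by
  unfold qKZ
  congr 3
  funext b
  rw [qR, Equiv.swap_comm]

lemma qfilter (n : ℕ) (p s : List (Fin n)) (x : Fin n) (h : p ++ x :: s = List.finRange n) :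
    (List.finRange n).filter (fun b => b < x) = p ∧
    (List.finRange n).filter (fun b => x < b) = s := by
  have hp : (List.finRange n).Pairwise (· < ·) := List.pairwise_lt_finRange n
  rw [← h, List.pairwise_append, List.pairwise_cons] at hp
  obtain ⟨h1, ⟨h2, h3⟩, h4⟩ := hp
  have e1 : ∀ a ∈ p, a < x := fun a ha => h4 a ha x List.mem_cons_self
  rw [← h]
  simp only [List.filter_append, List.filter_cons, lt_irrefl, decide_false]
  constructor
  · rw [List.filter_eq_self.2 (by simpa using e1),
      List.filter_eq_nil_iff.2 (by intro b hb; simpa using (h2 b hb).le)]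
    simp
  · rw [List.filter_eq_nil_iff.2 (by intro b hb; simpa using (e1 b hb).le),
      List.filter_eq_self.2 (by simpa using h2)]
    simp

lemma qprod (n : ℕ) (g : Fin n → Fin n → ℂ) :
    ((List.finRange n).map (fun x => (((List.finRange n).filter (fun b => b < x)).map
      (fun a => g a x * g x a)).prod)).prod
    = ∏ p ∈ Finset.univ.filter (fun p : Fin n × Fin n => p.1 ≠ p.2), g p.1 p.2 := by
  have e : ∀ x : Fin n, (((List.finRange n).filter (fun b => b < x)).map
      (fun a => g a x * g x a)).prod = ∏ a, if a < x then g a x * g x a else 1 := by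
    intro x
    rw [← Finset.prod_filter, ← List.prod_toFinset _ ((List.nodup_finRange n).filter _)]
    congr 1
    ext; simp
  simp only [e]
  rw [← List.prod_toFinset _ (List.nodup_finRange n), List.toFinset_finRange,
    Finset.prod_filter, Fintype.prod_prod_type]
  have e2 : ∀ x a : Fin n, (if a < x then g a x * g x a else 1)
      = (if a < x then g a x else 1) * (if a < x then g x a else 1) := by
    intro x a; split_ifs <;> simp
  simp only [e2, Finset.prod_mul_distrib]
  rw [Finset.prod_comm, ← Finset.prod_mul_distrib]
  refine Finset.prod_congr rfl fun x _ => ?_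
  rw [← Finset.prod_mul_distrib]
  refine Finset.prod_congr rfl fun y _ => ?_
  rcases lt_trichotomy x y with h | h | h
  · simp [h, h.ne, h.not_gt]
  · simp [h]
  · simp [h, h.ne', h.not_gt]

lemma qR_unit (n : ℕ) (z : Fin n → ℂ) (ℏ : ℂ) (hne : ∀ a b : Fin n, z a - z b ≠ ℏ)
    (a b : Fin n) : IsUnit (qR n z ℏ a b) := by
  have hc : (z a - z b + ℏ) * (z b - z a + ℏ) ≠ 0 := by
    apply mul_ne_zero
    · intro h; apply hne b a; linear_combination -h
    · intro h; apply hne a b; linear_combination -h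
  have h1 := qR_inv n z ℏ a b
  have h2 := qR_inv n z ℏ b a
  rw [mul_comm (z b - z a + ℏ)] at h2
  have hu := (IsUnit.mk0 _ hc).map (algebraMap ℂ (MonoidAlgebra ℂ (Equiv.Perm (Fin n))))
  have hcm : Commute (qR n z ℏ a b) (qR n z ℏ b a) := h1.trans h2.symm
  exact (hcm.isUnit_mul_iff.1 (h1 ▸ hu)).1

/-- for distinct `z_1, ..., z_n` with `z_a - z_b ≠ ℏ` for all `a,b`, the
product `K_1^{(n)} ⋯ K_n^{(n)}` of the qKZ elements equals the scalar
`∏_{a ≠ b} (z_a - z_b + ℏ)`; in particular each `K_a^{(n)}` is invertible in `ℂ[S_n]`. -/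
theorem stmt_8 (n : ℕ) (z : Fin n → ℂ) (ℏ : ℂ) (hz : Function.Injective z)
    (hne : ∀ a b : Fin n, z a - z b ≠ ℏ) :
    ((List.finRange n).map (qKZ n z ℏ)).prod
        = algebraMap ℂ (MonoidAlgebra ℂ (Equiv.Perm (Fin n)))
            (∏ p ∈ Finset.univ.filter (fun p : Fin n × Fin n => p.1 ≠ p.2),
              (z p.1 - z p.2 + ℏ))
      ∧ ∀ a, IsUnit (qKZ n z ℏ a) := by
  constructor
  · have h := qaux_main (qR n z ℏ) (fun a b => (z a - z b + ℏ) * (z b - z a + ℏ)) (qKZ n z ℏ)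
      (fun x => (((List.finRange n).filter (fun b => b < x)).map
        (fun a => (z a - z x + ℏ) * (z x - z a + ℏ))).prod) (List.finRange n)
      (List.nodup_finRange n) (fun a b _ => qR_inv n z ℏ a b)
      (fun a x b k => qR_comm n z ℏ a x b k)
      (fun p x s h => by rw [qKZ_eq, (qfilter n p s x h).1, (qfilter n p s x h).2])
      (fun p x s h => by rw [(qfilter n p s x h).1])
      (List.finRange n) [] rfl
    rw [qprod n (fun a b => z a - z b + ℏ)] at h
    simpa using h
  · intro a
    rw [qKZ_eq]
    have hl : ∀ l : List (Fin n), IsUnit (l.map (qR n z ℏ a)).prod := by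
      intro l
      induction l with
      | nil => simp
      | cons b l ih => simpa using (qR_unit n z ℏ hne a b).mul ih
    exact (hl _).mul (hl _)

end
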